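/- Let ξ be a polarizing vector for P and let p ∈ Vert(P) be a vertex at which the linear functional x ↦ ⟨x, ξ⟩ attains its minimum over P. Then: (i) E_p^−(ξ) = ∅; (ii) the interior P° of P is contained in Č_p^#(ξ); and (iii) for every vertex q ∈ Vert(P) with E_q^−(ξ) ≠ ∅ (in particular for every vertex q ≠ p), Č_q^#(ξ) ∩ P° = ∅. -/

import Mathlib

open Module

/-- If a set lies in the simplicial cone at `q` spanned by linearly independent vectors `v i`, then
every interior point of the set has strictly positive coordinates. -/
theorem coord_pos_of_mem_interior {E ι : Type*} [NormedAddCommGroup E] [NormedSpace ℝ E]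
    [Fintype ι] {P : Set E} {q : E} {v : ι → E} (hv : LinearIndependent ℝ v)
    (hP : ∀ y ∈ P, ∃ c : ι → ℝ, (∀ i, 0 ≤ c i) ∧ y = q + ∑ i, c i • v i)
    {c : ι → ℝ} (hy : q + ∑ i, c i • v i ∈ interior P) (i : ι) : 0 < c i := by
  classical
  have hcont : Continuous fun t : ℝ => q + ∑ j, c j • v j - t • v i := by fun_prop
  have hev : ∀ᶠ t in nhds (0 : ℝ), q + ∑ j, c j • v j - t • v i ∈ interior P :=
    hcont.continuousAt.eventually_mem (isOpen_interior.mem_nhds (by simpa using hy))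
  obtain ⟨t, ht, ht0⟩ :=
    ((hev.filter_mono nhdsWithin_le_nhds).and (self_mem_nhdsWithin (s := Set.Ioi (0 : ℝ)))).exists
  obtain ⟨d, hd, hyd⟩ := hP _ (interior_subset ht)
  have hsum : ∑ j, (c j - t * (if j = i then 1 else 0)) • v j = ∑ j, d j • v j := by
    rw [add_sub_assoc] at hyd
    rw [← add_left_cancel hyd]
    simp [sub_smul, Finset.sum_sub_distrib, ite_smul]
  have hci : c i - t * (if i = i then 1 else 0) = d i :=
    congrFun (hv.fintypeLinearCombination_injective (by
      simpa only [Fintype.linearCombination_apply] using hsum)) i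
  have hdi := hd i
  have ht0' : 0 < t := ht0
  simp only [if_true, mul_one] at hci
  linarith

/-- Let `ξ` be a polarizing vector for the simple convex polytope `P` and
let `p` be a vertex at which `x ↦ ⟨x, ξ⟩` attains its minimum over `P`.  Then
(i) `E_p^−(ξ) = ∅`; (ii) `P° ⊆ Č_p^#(ξ)`; (iii) for every vertex `q` with
`E_q^−(ξ) ≠ ∅`, `Č_q^#(ξ) ∩ P° = ∅`; and in particular (iv) the same holds
for every vertex `q ≠ p`.
`E` plays the role of the dual space `V*`, and `ξ ∈ V` is represented by the
corresponding functional `ξ : Module.Dual ℝ E` (via `V ≅ V**`), so that the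
pairing `⟨w, ξ⟩` becomes `ξ w`. -/
theorem min_vertex_dual_polarized_cone
    {E : Type*} [NormedAddCommGroup E] [NormedSpace ℝ E] [FiniteDimensional ℝ E]
    {n : ℕ} (hdim : finrank ℝ E = n)
    (P : Set E) (Vert : Finset E) (w : E → Fin n → E)
    (hPcompact : IsCompact P)
    (hPhull : P = convexHull ℝ (Vert : Set E))
    (hindep : ∀ p ∈ Vert, LinearIndependent ℝ (w p))
    (hspan : ∀ p ∈ Vert, Submodule.span ℝ (Set.range (w p)) = ⊤)
    (htangent : ∀ p ∈ Vert,
      {y : E | ∃ r : ℝ, 0 ≤ r ∧ ∃ x ∈ P, y = p + r • (x - p)} =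
        {y : E | ∃ c : Fin n → ℝ, (∀ i, 0 ≤ c i) ∧ y = p + ∑ i, c i • w p i})
    (ξ : Module.Dual ℝ E)
    (hpol : ∀ p ∈ Vert, ∀ i, ξ (w p i) ≠ 0)
    (p : E) (hp : p ∈ Vert)
    (hmin : ∀ y ∈ P, ξ p ≤ ξ y) :
    (∀ i, ¬ ξ (w p i) < 0) ∧
    interior P ⊆
      {y : E | ∃ c : Fin n → ℝ,
        (∀ i, 0 < ξ (w p i) → 0 < c i) ∧
        (∀ i, ξ (w p i) < 0 → c i ≤ 0) ∧
        y = p + ∑ i, c i • w p i} ∧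
    (∀ q ∈ Vert, (∃ i, ξ (w q i) < 0) →
      {y : E | ∃ c : Fin n → ℝ,
        (∀ i, 0 < ξ (w q i) → 0 < c i) ∧
        (∀ i, ξ (w q i) < 0 → c i ≤ 0) ∧
        y = q + ∑ i, c i • w q i} ∩ interior P = ∅) ∧
    (∀ q ∈ Vert, q ≠ p →
      {y : E | ∃ c : Fin n → ℝ,
        (∀ i, 0 < ξ (w q i) → 0 < c i) ∧
        (∀ i, ξ (w q i) < 0 → c i ≤ 0) ∧
        y = q + ∑ i, c i • w q i} ∩ interior P = ∅) := by
  classical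
  have hcone : ∀ q ∈ Vert, ∀ y ∈ P,
      ∃ c : Fin n → ℝ, (∀ i, 0 ≤ c i) ∧ y = q + ∑ i, c i • w q i := fun q hq y hy =>
    (Set.ext_iff.mp (htangent q hq) y).mp ⟨1, zero_le_one, y, hy, by simp⟩
  have hneg : ∀ i, ¬ ξ (w p i) < 0 := by
    intro i hi
    obtain ⟨r, hr, x, hx, hxe⟩ := (Set.ext_iff.mp (htangent p hp) (p + w p i)).mpr
      ⟨Pi.single i 1, fun j => by rw [Pi.single_apply]; split_ifs <;> norm_num, by
        simp [Pi.single_apply, ite_smul]⟩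
    rw [add_left_cancel hxe, map_smul, map_sub, smul_eq_mul] at hi
    exact absurd hi (not_lt.mpr (mul_nonneg hr (sub_nonneg.mpr (hmin x hx))))
  have hdisj : ∀ q ∈ Vert, (∃ i, ξ (w q i) < 0) →
      {y : E | ∃ c : Fin n → ℝ,
        (∀ i, 0 < ξ (w q i) → 0 < c i) ∧
        (∀ i, ξ (w q i) < 0 → c i ≤ 0) ∧
        y = q + ∑ i, c i • w q i} ∩ interior P = ∅ := by
    rintro q hq ⟨i, hi⟩
    refine Set.eq_empty_iff_forall_notMem.mpr ?_
    rintro y ⟨⟨c, -, hc, rfl⟩, hy⟩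
    exact absurd (hc i hi)
      (not_le.mpr (coord_pos_of_mem_interior (hindep q hq) (hcone q hq) hy i))
  refine ⟨hneg, ?_, hdisj, ?_⟩
  · intro y hy
    obtain ⟨c, -, rfl⟩ := hcone p hp y (interior_subset hy)
    exact ⟨c, fun i _ => coord_pos_of_mem_interior (hindep p hp) (hcone p hp) hy i,
      fun i hi => absurd hi (hneg i), rfl⟩
  · intro q hq hqp
    refine hdisj q hq ?_
    by_contra! hnonneg
    have hVP : (Vert : Set E) ⊆ P := hPhull ▸ subset_convexHull ℝ (Vert : Set E)
    obtain ⟨c, hc, hpc⟩ := hcone q hq p (hVP hp)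
    have hle : ∑ i, c i * ξ (w q i) ≤ 0 := by
      have h := hmin q (hVP hq)
      have hξ := congrArg ξ hpc
      simp only [map_add, map_sum, map_smul, smul_eq_mul] at hξ
      linarith
    have hterm : ∀ i ∈ Finset.univ, 0 ≤ c i * ξ (w q i) :=
      fun i _ => mul_nonneg (hc i) (hnonneg i)
    have hzero := (Finset.sum_eq_zero_iff_of_nonneg hterm).mp
      (le_antisymm hle (Finset.sum_nonneg hterm))
    have hc0 : ∀ i, c i = 0 := fun i =>
      (mul_eq_zero.mp (hzero i (Finset.mem_univ i))).resolve_right (hpol q hq i)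
    exact hqp (by simp [hpc, hc0])
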